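/- Let P ∈ 𝕂[X₁,…,Xₙ,U₁,…,Uₙ], f = E(P), and suppose V = Z(f) ⊆ ℝⁿ is an irreducible real algebraic set over 𝕂 with dim V = n−1. Then either V is one of the hyperplanes constituting W_P (i.e., V = {x ∈ ℝⁿ : d_{1ν}x₁+⋯+d_{nν}xₙ = d_{1μ}x₁+⋯+d_{nμ}xₙ} for some pair of distinct U-monomials of P for which this set is a hyperplane), or V × ℝⁿ is an irreducible component over 𝕂 of the algebraic set Z(P) ⊆ ℝ^{2n}. -/

import Mathlib

open MeasureTheory Set
open scoped ENNReal

noncomputable section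

/-- `K` is a real algebraic extension of `ℚ`: every element of `K` is algebraic over `ℚ`. -/
def RealAlgExt (K : Subfield ℝ) : Prop := ∀ a : K, IsAlgebraic ℚ (a : ℝ)

/-- A real polynomial has all its coefficients in the subfield `K` of `ℝ`. -/
def CoeffsIn {σ : Type*} (K : Subfield ℝ) (P : MvPolynomial σ ℝ) : Prop :=
  ∀ m, P.coeff m ∈ K

/-- Evaluation of a polynomial in `X₁,…,Xₙ,U₁,…,Uₙ` at `(x, e^x)`:
the E-polynomial associated to `P`. -/
def expEval {n : ℕ} (P : MvPolynomial (Fin n ⊕ Fin n) ℝ) (x : Fin n → ℝ) : ℝ :=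
  MvPolynomial.eval (Sum.elim x fun i => Real.exp (x i)) P

/-- Exponential sets over `K` in `ℝⁿ`: zero sets of E-polynomials over `K`. -/
def IsExpSet {n : ℕ} (K : Subfield ℝ) (V : Set (Fin n → ℝ)) : Prop :=
  ∃ P : MvPolynomial (Fin n ⊕ Fin n) ℝ, CoeffsIn K P ∧ V = {x | expEval P x = 0}

/-- Real algebraic sets over `K` (in coordinates indexed by `σ`). -/
def IsAlgSet {σ : Type*} (K : Subfield ℝ) (S : Set (σ → ℝ)) : Prop :=
  ∃ P : MvPolynomial σ ℝ, CoeffsIn K P ∧ S = {x | MvPolynomial.eval x P = 0}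

/-- An exponential set is irreducible if it is nonempty and is not the union of
two proper exponential subsets. -/
def IsIrredExpSet {n : ℕ} (K : Subfield ℝ) (V : Set (Fin n → ℝ)) : Prop :=
  IsExpSet K V ∧ V.Nonempty ∧
    ¬ ∃ V₁ V₂ : Set (Fin n → ℝ),
      IsExpSet K V₁ ∧ IsExpSet K V₂ ∧ V = V₁ ∪ V₂ ∧ V₁ ⊂ V ∧ V₂ ⊂ V

/-- `T` is an irreducible component of `V`: a maximal irreducible exponential subset of `V`. -/
def IsExpComponent {n : ℕ} (K : Subfield ℝ) (T V : Set (Fin n → ℝ)) : Prop :=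
  IsIrredExpSet K T ∧ T ⊆ V ∧
    ∀ T', IsIrredExpSet K T' → T ⊆ T' → T' ⊆ V → T' = T

/-- A real algebraic set is irreducible over `K` if it is nonempty and is not the union of
two proper algebraic subsets over `K`. -/
def IsIrredAlgSet {σ : Type*} (K : Subfield ℝ) (V : Set (σ → ℝ)) : Prop :=
  IsAlgSet K V ∧ V.Nonempty ∧
    ¬ ∃ V₁ V₂ : Set (σ → ℝ),
      IsAlgSet K V₁ ∧ IsAlgSet K V₂ ∧ V = V₁ ∪ V₂ ∧ V₁ ⊂ V ∧ V₂ ⊂ V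

/-- `T` is an irreducible component over `K` of the real algebraic set `V`. -/
def IsAlgComponent {σ : Type*} (K : Subfield ℝ) (T V : Set (σ → ℝ)) : Prop :=
  IsIrredAlgSet K T ∧ T ⊆ V ∧
    ∀ T', IsIrredAlgSet K T' → T ⊆ T' → T' ⊆ V → T' = T

/-- Local (Hausdorff) dimension of `A` at `x`. -/
def locDim {n : ℕ} (A : Set (Fin n → ℝ)) (x : Fin n → ℝ) : ℝ≥0∞ :=
  ⨅ (ε : ℝ) (_ : 0 < ε), dimH (A ∩ Metric.ball x ε)

/-- `A_p`: the set of points of `A` at which `A` has local dimension `p`. -/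
def localSet {n : ℕ} (A : Set (Fin n → ℝ)) (p : ℕ) : Set (Fin n → ℝ) :=
  {x | x ∈ A ∧ locDim A x = (p : ℝ≥0∞)}

/-- The exponent vectors of the `U`-monomials of `P` (with nonzero coefficient in `𝕂[X]`). -/
def Uexps {n : ℕ} (P : MvPolynomial (Fin n ⊕ Fin n) ℝ) : Set (Fin n → ℕ) :=
  (fun (m : (Fin n ⊕ Fin n) →₀ ℕ) (i : Fin n) => m (Sum.inr i)) '' (P.support : Set _)

/-- The union `W_P` of the linear hyperplane sets associated to pairs of distinct
`U`-monomials of `P`. -/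
def WP {n : ℕ} (P : MvPolynomial (Fin n ⊕ Fin n) ℝ) : Set (Fin n → ℝ) :=
  {x | ∃ d e : Fin n → ℕ, d ∈ Uexps P ∧ e ∈ Uexps P ∧ d ≠ e ∧
    ∑ i, (d i : ℝ) * x i = ∑ i, (e i : ℝ) * x i}

/-- Schanuel's conjecture over the reals, with "the transcendence degree of
`ℚ(x₁,…,xₙ,e^{x₁},…,e^{xₙ})` over `ℚ` is less than `n`" expressed as: no `n`-tuple of
elements of `{x₁,…,xₙ,e^{x₁},…,e^{xₙ}}` is algebraically independent over `ℚ`. -/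
def SchanuelConjecture : Prop :=
  ∀ (n : ℕ) (x : Fin n → ℝ),
    (¬ ∃ v : Fin n → ℝ,
        (∀ i, v i ∈ Set.range x ∪ Set.range fun j => Real.exp (x j)) ∧
        AlgebraicIndependent ℚ v) →
    ∃ m : Fin n → ℤ, (∃ i, m i ≠ 0) ∧ ∑ i, (m i : ℝ) * x i = 0


theorem exists_int_polynomial_eval_zero_ne_zero {A : Type*} [CommRing A] [IsDomain A]
    [Algebra.IsAlgebraic ℤ A] (s : Finset A) (hs : (0 : A) ∉ s) :
    ∃ f : Polynomial ℤ, f.eval 0 ≠ 0 ∧ ∀ a ∈ s, Polynomial.aeval a f = 0 := by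
  classical
  have key : ∀ a : A, ∃ f : Polynomial ℤ, a ≠ 0 → (f.eval 0 ≠ 0 ∧ Polynomial.aeval a f = 0) := by
    intro a
    by_cases ha : a = 0
    · exact ⟨0, fun h => absurd ha h⟩
    · obtain ⟨q, hq, hq'⟩ := (Algebra.IsAlgebraic.isAlgebraic (R := ℤ)
        a).exists_nonzero_coeff_and_aeval_eq_zero (mem_nonZeroDivisors_of_ne_zero ha)
      exact ⟨q, fun _ => ⟨by rwa [← Polynomial.coeff_zero_eq_eval_zero], hq'⟩⟩
  choose f hf using key
  refine ⟨∏ a ∈ s, f a, ?_, fun a ha => ?_⟩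
  · rw [Polynomial.eval_prod, Finset.prod_ne_zero_iff]
    exact fun a ha => (hf a (ne_of_mem_of_not_mem ha hs)).1
  · rw [map_prod]
    exact Finset.prod_eq_zero ha (hf a (ne_of_mem_of_not_mem ha hs)).2

theorem isIntegral_pow_mul_aeval {A : Type*} [CommRing A] {k : ℤ} {a : A}
    (ha : IsIntegral ℤ (k • a)) (g : Polynomial ℤ) {D : ℕ} (hD : g.natDegree ≤ D) :
    IsIntegral ℤ ((k : A) ^ D * Polynomial.aeval a g) := by
  rw [Polynomial.aeval_eq_sum_range, Finset.mul_sum]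
  refine IsIntegral.sum _ fun i hi => ?_
  have hi' : i ≤ D := by rw [Finset.mem_range] at hi; omega
  have : (k : A) ^ D * (g.coeff i • a ^ i) =
      ((k ^ (D - i) * g.coeff i : ℤ) : A) * (k • a) ^ i := by
    rw [zsmul_eq_mul, zsmul_eq_mul, mul_pow]
    push_cast
    rw [← Nat.sub_add_cancel hi', pow_add, Nat.sub_add_cancel hi']
    ring
  rw [this]
  exact IsIntegral.mul (by exact_mod_cast isIntegral_algebraMap) (ha.pow i)

/-- A Galois-invariant integral element of a Galois number field is a rational integer. -/
theorem exists_int_of_isIntegral_of_forall_gal {L : Type*} [Field L] [NumberField L]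
    [IsGalois ℚ L] {x : L} (hx : IsIntegral ℤ x) (hfix : ∀ τ : L ≃ₐ[ℚ] L, τ x = x) :
    ∃ m : ℤ, (m : L) = x := by
  obtain ⟨q, rfl⟩ := (IsGalois.mem_range_algebraMap_iff_fixed x).2 hfix
  have hq : IsIntegral ℤ q := (isIntegral_algebraMap_iff (algebraMap ℚ L).injective).1 hx
  obtain ⟨m, rfl⟩ := IsIntegrallyClosed.isIntegral_iff.1 hq
  exact ⟨m, by simp⟩

theorem exists_prime_gt_mul_pow_div_factorial_lt_one (N : ℕ) (C c : ℝ) :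
    ∃ p, N < p ∧ p.Prime ∧ C * c ^ p / (p - 1).factorial < 1 := by
  have h := (FloorSemiring.tendsto_pow_div_factorial_atTop c).const_mul (C * c)
  rw [mul_zero] at h
  obtain ⟨M, hM⟩ := Filter.eventually_atTop.1 (h.eventually (gt_mem_nhds zero_lt_one))
  obtain ⟨p, hp, hpp⟩ := Nat.exists_infinite_primes (M + N + 2)
  refine ⟨p, by omega, hpp, ?_⟩
  have := hM (p - 1) (by omega)
  calc C * c ^ p / (p - 1).factorial = C * c * (c ^ (p - 1) / (p - 1).factorial) := by
        conv_lhs => rw [← Nat.sub_add_cancel hpp.one_le, pow_succ]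
        simp only [Nat.add_sub_cancel]
        ring
    _ < 1 := this

/-- Galois-invariant integer combinations of exponentials of algebraic numbers with nonzero
constant term do not vanish. -/
theorem finsupp_sum_mul_exp_ne_zero {L : Type*} [Field L] [NumberField L] [IsGalois ℚ L]
    (ι : L →+* ℂ) (d : L →₀ ℤ) (hinv : ∀ (τ : L ≃ₐ[ℚ] L) (γ : L), d (τ γ) = d γ)
    (h0 : d 0 ≠ 0) : d.sum (fun γ c => (c : ℂ) * Complex.exp (ι γ)) ≠ 0 := by
  classical
  intro hsum
  set s : Finset L := d.support.erase 0 with hs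
  have : Algebra.IsAlgebraic ℤ L :=
    (IsFractionRing.comap_isAlgebraic_iff (A := ℤ) (K := ℚ) (C := L)).2 inferInstance
  obtain ⟨f, hf0, hf⟩ := exists_int_polynomial_eval_zero_ne_zero s (by simp [hs])
  obtain ⟨c, hc⟩ := LindemannWeierstrass.exp_polynomial_approx f hf0
  obtain ⟨k, hk0, hk⟩ := Algebra.IsAlgebraic.exists_integral_multiples ℤ s
  set D := f.natDegree
  obtain ⟨p, hpN, hpp, hlt⟩ := exists_prime_gt_mul_pow_div_factorial_lt_one
    ((f.eval 0).natAbs + k.natAbs + (d 0).natAbs) (∑ γ ∈ s, |(d γ : ℝ)|) (|(k : ℝ)| ^ D * c)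
  obtain ⟨n, hpn, g, hg, happrox⟩ := hc p (by omega) hpp
  have hgD : g.natDegree ≤ p * D := hg.trans (Nat.sub_le _ _)
  obtain ⟨N, hN⟩ : ∃ N : ℤ, (N : L) =
      ∑ γ ∈ s, (d γ : L) * ((k : L) ^ (p * D) * Polynomial.aeval γ g) := by
    refine exists_int_of_isIntegral_of_forall_gal (IsIntegral.sum _ fun γ hγ => ?_) fun τ => ?_
    · exact IsIntegral.mul (by exact_mod_cast isIntegral_algebraMap)
        (isIntegral_pow_mul_aeval (hk γ hγ) g hgD)
    · rw [map_sum]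
      refine Finset.sum_bij (fun γ _ => τ γ) ?_ (fun _ _ _ _ h => τ.injective h) ?_ ?_
      · intro γ hγ
        simpa [hs, hinv] using hγ
      · intro γ hγ
        refine ⟨τ.symm γ, ?_, by simp⟩
        have := hinv τ (τ.symm γ)
        simp only [AlgEquiv.apply_symm_apply] at this
        simpa [hs, ← this] using hγ
      · intro γ hγ
        rw [hinv]
        simp only [map_mul, map_intCast, map_pow]
        congr 2
        exact (Polynomial.aeval_algHom_apply (τ.toAlgHom.restrictScalars ℤ) γ g).symm
  have hNC : (N : ℂ) = ∑ γ ∈ s, (d γ : ℂ) * ((k : ℂ) ^ (p * D) * Polynomial.aeval (ι γ) g) := by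
    have := congrArg ι hN
    simp only [map_sum, map_mul, map_intCast, map_pow] at this
    rw [this]
    refine Finset.sum_congr rfl fun γ _ => ?_
    congr 2
    exact (Polynomial.aeval_algHom_apply ι.toIntAlgHom γ g).symm
  have hsplit : (d 0 : ℂ) + ∑ γ ∈ s, (d γ : ℂ) * Complex.exp (ι γ) = 0 := by
    rw [Finsupp.sum, ← Finset.add_sum_erase _ _ (Finsupp.mem_support_iff.2 h0)] at hsum
    simpa using hsum
  set M : ℤ := k ^ (p * D) * (n * d 0) + p * N with hM
  have hMne : M ≠ 0 := by
    intro hM0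
    have hdvd : (p : ℤ) ∣ k ^ (p * D) * (n * d 0) := by
      have : k ^ (p * D) * (n * d 0) = p * (-N) := by linarith
      exact this ▸ dvd_mul_right _ _
    have hp' := Nat.prime_iff_prime_int.1 hpp
    have hsmall : ∀ a : ℤ, a ≠ 0 → a.natAbs < p → ¬ (p : ℤ) ∣ a := fun a ha hap h =>
      absurd (Nat.le_of_dvd (Int.natAbs_pos.2 ha) (Int.natCast_dvd.1 h)) (by omega)
    rcases hp'.dvd_or_dvd hdvd with h | h
    · exact hsmall k hk0 (by omega) (hp'.dvd_of_dvd_pow h)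
    · rcases hp'.dvd_or_dvd h with h | h
      · exact hpn h
      · exact hsmall _ h0 (by omega) h
  have hMC : (M : ℂ) = -((k : ℂ) ^ (p * D) *
      ∑ γ ∈ s, (d γ : ℂ) * (n • Complex.exp (ι γ) - p • Polynomial.aeval (ι γ) g)) := by
    have h1 : ∑ γ ∈ s, (d γ : ℂ) * (n • Complex.exp (ι γ) - p • Polynomial.aeval (ι γ) g) =
        n * ∑ γ ∈ s, (d γ : ℂ) * Complex.exp (ι γ) -
          p * ∑ γ ∈ s, (d γ : ℂ) * Polynomial.aeval (ι γ) g := by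
      rw [Finset.mul_sum, Finset.mul_sum, ← Finset.sum_sub_distrib]
      refine Finset.sum_congr rfl fun γ _ => ?_
      simp only [zsmul_eq_mul, nsmul_eq_mul]
      ring
    have h2 : (N : ℂ) = (k : ℂ) ^ (p * D) * ∑ γ ∈ s, (d γ : ℂ) * Polynomial.aeval (ι γ) g := by
      rw [hNC, Finset.mul_sum]
      exact Finset.sum_congr rfl fun γ _ => by ring
    rw [h1, hM]
    push_cast
    rw [h2]
    linear_combination (k : ℂ) ^ (p * D) * n * hsplit
  have hnorm : ‖(M : ℂ)‖ ≤
      (∑ γ ∈ s, |(d γ : ℝ)|) * (|(k : ℝ)| ^ D * c) ^ p / (p - 1).factorial := by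
    rw [hMC, norm_neg, norm_mul, norm_pow, Complex.norm_intCast]
    calc |(k : ℝ)| ^ (p * D) * ‖∑ γ ∈ s, (d γ : ℂ) *
          (n • Complex.exp (ι γ) - p • Polynomial.aeval (ι γ) g)‖
        ≤ |(k : ℝ)| ^ (p * D) * ∑ γ ∈ s, |(d γ : ℝ)| * (c ^ p / (p - 1).factorial) := by
          gcongr
          refine (norm_sum_le _ _).trans (Finset.sum_le_sum fun γ hγ => ?_)
          rw [norm_mul, Complex.norm_intCast]
          gcongr
          refine happrox ?_
          rw [Polynomial.mem_aroots]
          refine ⟨fun h => hf0 (by simp [h]), ?_⟩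
          have := Polynomial.aeval_algHom_apply ι.toIntAlgHom γ f
          rw [hf γ hγ, map_zero] at this
          exact this
      _ = _ := by
          rw [← Finset.sum_mul, mul_pow, ← pow_mul, mul_comm D p]
          ring
  have h1 : (1 : ℝ) ≤ ‖(M : ℂ)‖ := by
    rw [Complex.norm_intCast]
    exact_mod_cast Int.one_le_abs hMne
  exact absurd (h1.trans hnorm) (not_le.2 hlt)

/-- The ring homomorphism from the group algebra `L[L]` to `ℂ` sending `∑ β [α]` to
`∑ β e^α`, for a field `L` embedded in `ℂ`. -/
def expRingHom {L : Type*} [Field L] (ι : L →+* ℂ) : AddMonoidAlgebra L L →+* ℂ :=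
  AddMonoidAlgebra.liftNCRingHom ι
    { toFun := fun x => Complex.exp (ι x.toAdd)
      map_one' := by simp
      map_mul' := fun x y => by simp [Complex.exp_add] } fun _ _ => Commute.all _ _

theorem expRingHom_single {L : Type*} [Field L] (ι : L →+* ℂ) (α β : L) :
    expRingHom ι (AddMonoidAlgebra.single α β) = ι β * Complex.exp (ι α) := by
  simp [expRingHom]

theorem expRingHom_apply {L : Type*} [Field L] (ι : L →+* ℂ) (a : AddMonoidAlgebra L L) :
    expRingHom ι a = ∑ γ ∈ a.coeff.support, ι (a.coeff γ) * Complex.exp (ι γ) := by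
  conv_lhs => rw [← AddMonoidAlgebra.ofCoeff_coeff a, ← Finsupp.sum_single a.coeff]
  rw [Finsupp.sum, AddMonoidAlgebra.ofCoeff_sum, map_sum]
  exact Finset.sum_congr rfl fun γ _ => expRingHom_single ι γ _

/-- The action of a pair of automorphisms of `L` on the group algebra `L[L]`, the first acting
on coefficients, the second on exponents. -/
def galAct {L : Type*} [Field L] [Algebra ℚ L] (σ : (L ≃ₐ[ℚ] L) × (L ≃ₐ[ℚ] L)) :
    AddMonoidAlgebra L L →+* AddMonoidAlgebra L L :=
  (AddMonoidAlgebra.mapRingHom L (σ.1 : L →+* L)).comp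
    (AddMonoidAlgebra.mapDomainRingHom L (σ.2 : L →+ L))

theorem galAct_single {L : Type*} [Field L] [Algebra ℚ L]
    (σ : (L ≃ₐ[ℚ] L) × (L ≃ₐ[ℚ] L)) (α β : L) :
    galAct σ (AddMonoidAlgebra.single α β) = AddMonoidAlgebra.single (σ.2 α) (σ.1 β) := by
  simp [galAct]

theorem coeff_galAct {L : Type*} [Field L] [Algebra ℚ L]
    (σ : (L ≃ₐ[ℚ] L) × (L ≃ₐ[ℚ] L)) (a : AddMonoidAlgebra L L) (γ : L) :
    (galAct σ a).coeff (σ.2 γ) = σ.1 (a.coeff γ) := by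
  simp only [galAct, RingHom.comp_apply, AddMonoidAlgebra.coeff_mapRingHom]
  exact congrArg σ.1 (Finsupp.mapDomain_apply σ.2.injective a.coeff γ)

theorem galAct_mul {L : Type*} [Field L] [Algebra ℚ L]
    (σ τ : (L ≃ₐ[ℚ] L) × (L ≃ₐ[ℚ] L)) (a : AddMonoidAlgebra L L) :
    galAct σ (galAct τ a) = galAct (σ * τ) a := by
  ext γ
  obtain ⟨γ, rfl⟩ := (σ * τ).2.surjective γ
  rw [coeff_galAct]
  change (galAct σ (galAct τ a)).coeff (σ.2 (τ.2 γ)) = _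
  rw [coeff_galAct, coeff_galAct]
  rfl

theorem galAct_injective {L : Type*} [Field L] [Algebra ℚ L]
    (σ : (L ≃ₐ[ℚ] L) × (L ≃ₐ[ℚ] L)) : Function.Injective (galAct (L := L) σ) := by
  intro a b h
  ext γ
  apply σ.1.injective
  rw [← coeff_galAct, ← coeff_galAct, h]

theorem galAct_one {L : Type*} [Field L] [Algebra ℚ L] (a : AddMonoidAlgebra L L) :
    galAct 1 a = a := by
  ext γ
  exact coeff_galAct 1 a γ

/-- The **Lindemann–Weierstrass theorem** over a Galois number field. -/
theorem expRingHom_injective {L : Type*} [Field L] [NumberField L] [IsGalois ℚ L]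
    (ι : L →+* ℂ) : Function.Injective (expRingHom ι) := by
  classical
  rw [injective_iff_map_eq_zero]
  intro a ha
  by_contra ha0
  set c : AddMonoidAlgebra L L := ∏ σ : (L ≃ₐ[ℚ] L) × (L ≃ₐ[ℚ] L), galAct σ a with hcdef
  have hc0 : c ≠ 0 := Finset.prod_ne_zero_iff.2 fun σ _ =>
    (map_ne_zero_iff _ (galAct_injective σ)).2 ha0
  have hcinv : ∀ σ, galAct σ c = c := by
    intro σ
    rw [hcdef, map_prod]
    simp only [galAct_mul]
    exact Fintype.prod_equiv (Equiv.mulLeft σ) _ _ fun _ => rfl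
  have hcΦ : expRingHom ι c = 0 := by
    rw [hcdef, map_prod]
    exact Finset.prod_eq_zero (Finset.mem_univ 1) (by rw [galAct_one, ha])
  obtain ⟨α, hα⟩ : ∃ α, c.coeff α ≠ 0 := by
    by_contra! h
    exact hc0 (by ext γ; simp [h γ])
  set d : AddMonoidAlgebra L L :=
    c * ∑ τ : L ≃ₐ[ℚ] L, AddMonoidAlgebra.single (-(τ α)) 1 with hd
  have hdinv : ∀ σ, galAct σ d = d := by
    intro σ
    rw [hd, map_mul, hcinv, map_sum]
    congr 1
    simp only [galAct_single, map_one, map_neg]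
    exact Fintype.sum_equiv (Equiv.mulLeft σ.2) _ _ fun _ => rfl
  have hdΦ : expRingHom ι d = 0 := by rw [hd, map_mul, hcΦ, zero_mul]
  have hd0 : d.coeff 0 ≠ 0 := by
    have : d.coeff 0 = ∑ _τ : L ≃ₐ[ℚ] L, c.coeff α := by
      rw [hd, Finset.mul_sum, AddMonoidAlgebra.coeff_sum, Finsupp.finsetSum_apply]
      refine Finset.sum_congr rfl fun τ _ => ?_
      have h := coeff_galAct (1, τ) c α
      rw [hcinv] at h
      rw [AddMonoidAlgebra.coeff_mul_single_apply, zero_add, neg_neg, mul_one]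
      exact h
    rw [this, Finset.sum_const, nsmul_eq_mul]
    exact mul_ne_zero (Nat.cast_ne_zero.2 (by simp)) hα
  have hdc : ∀ (τ : L ≃ₐ[ℚ] L) γ, d.coeff (τ γ) = d.coeff γ := fun τ γ => by
    have := coeff_galAct (1, τ) d γ
    rwa [hdinv] at this
  have hdf : ∀ (σ : L ≃ₐ[ℚ] L) γ, σ (d.coeff γ) = d.coeff γ := fun σ γ => by
    have := coeff_galAct (σ, 1) d γ
    rw [hdinv] at this
    exact this.symm
  have : Algebra.IsAlgebraic ℤ L :=
    (IsFractionRing.comap_isAlgebraic_iff (A := ℤ) (K := ℚ) (C := L)).2 inferInstance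
  obtain ⟨k, hk0, hk⟩ := Algebra.IsAlgebraic.exists_integral_multiples ℤ
    (d.coeff.support.image d.coeff)
  have hm : ∀ γ, ∃ m : ℤ, (m : L) = k • d.coeff γ := by
    intro γ
    refine exists_int_of_isIntegral_of_forall_gal ?_ fun σ => by rw [map_zsmul, hdf]
    by_cases hγ : d.coeff γ = 0
    · rw [hγ, smul_zero]; exact isIntegral_zero
    · exact hk _ (Finset.mem_image_of_mem _ (Finsupp.mem_support_iff.2 hγ))
  choose m hm using hm
  have hmne : ∀ γ, m γ ≠ 0 ↔ d.coeff γ ≠ 0 := fun γ => by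
    rw [← Int.cast_ne_zero (α := L), hm, smul_ne_zero_iff]
    exact ⟨fun h => h.2, fun h => ⟨hk0, h⟩⟩
  let e : L →₀ ℤ := Finsupp.onFinset d.coeff.support m fun γ hγ =>
    Finsupp.mem_support_iff.2 ((hmne γ).1 hγ)
  refine finsupp_sum_mul_exp_ne_zero ι e (fun τ γ => ?_) ((hmne 0).2 hd0) ?_
  · change m (τ γ) = m γ
    rw [← Int.cast_inj (α := L), hm, hm, hdc]
  · rw [Finsupp.onFinset_sum _ (by simp)]
    have : ∀ γ, ((m γ : ℤ) : ℂ) = k * ι (d.coeff γ) := fun γ => by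
      rw [← map_intCast ι, hm, zsmul_eq_mul, map_mul, map_intCast]
    simp only [this, mul_assoc]
    rw [← Finset.mul_sum, ← expRingHom_apply, hdΦ, mul_zero]

/-- The **Lindemann–Weierstrass theorem**: exponentials of distinct algebraic numbers are
linearly independent over the algebraic numbers. -/
theorem lindemann_weierstrass {κ : Type*} (s : Finset κ) (α β : κ → ℂ)
    (hα : ∀ i ∈ s, IsAlgebraic ℚ (α i)) (hβ : ∀ i ∈ s, IsAlgebraic ℚ (β i))
    (hinj : Set.InjOn α s) (hsum : ∑ i ∈ s, β i * Complex.exp (α i) = 0) :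
    ∀ i ∈ s, β i = 0 := by
  classical
  set S : Finset ℂ := s.image α ∪ s.image β
  have hS : ∀ x ∈ S, IsAlgebraic ℚ x := by
    intro x hx
    rcases Finset.mem_union.1 hx with h | h <;> obtain ⟨i, hi, rfl⟩ := Finset.mem_image.1 h
    exacts [hα i hi, hβ i hi]
  set q : Polynomial ℚ := ∏ x ∈ S, minpoly ℚ x with hq
  have hq0 : q ≠ 0 := Finset.prod_ne_zero_iff.2 fun x hx => minpoly.ne_zero (hS x hx).isIntegral
  let L : IntermediateField ℚ ℂ := IntermediateField.adjoin ℚ (q.rootSet ℂ)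
  have : q.IsSplittingField ℚ L :=
    IntermediateField.adjoin_rootSet_isSplittingField (IsAlgClosed.splits _)
  have : FiniteDimensional ℚ L := Polynomial.IsSplittingField.finiteDimensional L q
  have : Normal ℚ L := Normal.of_isSplittingField q
  have : NumberField L := ⟨⟩
  have : IsGalois ℚ L := ⟨⟩
  have hL : ∀ x ∈ S, x ∈ L := fun x hx => IntermediateField.subset_adjoin _ _ <| by
    rw [Polynomial.mem_rootSet]
    refine ⟨hq0, ?_⟩
    rw [hq, map_prod]
    exact Finset.prod_eq_zero hx (minpoly.aeval ℚ x)
  have hαL : ∀ i, ∃ y : L, i ∈ s → (y : ℂ) = α i := fun i => by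
    by_cases hi : i ∈ s
    · exact ⟨⟨α i, hL _ (Finset.mem_union_left _ (Finset.mem_image_of_mem _ hi))⟩, fun _ => rfl⟩
    · exact ⟨0, fun h => absurd h hi⟩
  have hβL : ∀ i, ∃ y : L, i ∈ s → (y : ℂ) = β i := fun i => by
    by_cases hi : i ∈ s
    · exact ⟨⟨β i, hL _ (Finset.mem_union_right _ (Finset.mem_image_of_mem _ hi))⟩, fun _ => rfl⟩
    · exact ⟨0, fun h => absurd h hi⟩
  choose α' hα' using hαL
  choose β' hβ' using hβL
  have hzero : ∑ i ∈ s, AddMonoidAlgebra.single (α' i) (β' i) = 0 := by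
    apply expRingHom_injective (algebraMap L ℂ)
    rw [map_sum, map_zero, ← hsum]
    refine Finset.sum_congr rfl fun i hi => ?_
    rw [expRingHom_single]
    change (β' i : ℂ) * Complex.exp (α' i : ℂ) = _
    rw [hα' i hi, hβ' i hi]
  intro i hi
  have h := congrArg (fun a => a.coeff (α' i)) hzero
  simp only [AddMonoidAlgebra.coeff_sum, Finsupp.finsetSum_apply,
    AddMonoidAlgebra.coeff_single, AddMonoidAlgebra.coeff_zero, Finsupp.coe_zero,
    Pi.zero_apply] at h
  rw [Finset.sum_eq_single_of_mem i hi, Finsupp.single_eq_same] at h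
  · rw [← hβ' i hi, h]; rfl
  · intro j hj hji
    refine Finsupp.single_eq_of_ne fun heq => hji (hinj hj hi ?_)
    rw [← hα' i hi, ← hα' j hj, heq]

/-- Hausdorff dimension does not drop under a map with invertible strict derivatives. -/
theorem dimH_le_dimH_image_of_hasStrictFDerivAt {E : Type*} [NormedAddCommGroup E]
    [NormedSpace ℝ E] [FiniteDimensional ℝ E] {G : E → E} {S : Set E}
    (hG : ∀ y ∈ S, ∃ A : E ≃L[ℝ] E, HasStrictFDerivAt G (A : E →L[ℝ] E) y) :
    dimH S ≤ dimH (G '' S) := by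
  by_contra! hlt
  obtain ⟨x, hxS, hx⟩ := exists_mem_nhdsWithin_lt_dimH_of_lt_dimH hlt
  obtain ⟨A, hGx⟩ := hG x hxS
  obtain ⟨t, hxt, ht, happ⟩ := hGx.approximates_deriv_on_open_nhds
  have hanti := happ.antilipschitz (A.subsingleton_or_nnnorm_symm_pos.imp id fun h =>
    NNReal.half_lt_self <| ne_of_gt <| inv_pos.2 h)
  have h1 : t ∩ S ∈ nhdsWithin x S := by
    rw [Set.inter_comm]
    exact inter_mem_nhdsWithin S (ht.mem_nhds hxt)
  refine (hx _ h1).not_ge ?_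
  calc dimH (t ∩ S) = dimH (Subtype.val '' ((Subtype.val : t → E) ⁻¹' S)) := by
        rw [Subtype.image_preimage_coe]
    _ = dimH ((Subtype.val : t → E) ⁻¹' S) := isometry_subtype_coe.dimH_image _
    _ ≤ dimH (t.domRestrict G '' ((Subtype.val : t → E) ⁻¹' S)) := hanti.le_dimH_image _
    _ ≤ dimH (G '' S) := dimH_mono <| by
        rintro _ ⟨y, hy, rfl⟩
        exact ⟨y, hy, rfl⟩

theorem dimH_coordinate_subspace_le {ι : Type*} [Fintype ι] (I : Finset ι) :
    dimH {z : ι → ℝ | ∀ j ∉ I, z j = 0} ≤ I.card := by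
  classical
  let φ : (I → ℝ) → ι → ℝ := fun w i => if h : i ∈ I then w ⟨i, h⟩ else 0
  have hφ : LipschitzWith 1 φ := by
    refine LipschitzWith.of_dist_le_mul fun v w => ?_
    rw [NNReal.coe_one, one_mul]
    refine (dist_pi_le_iff dist_nonneg).2 fun i => ?_
    by_cases h : i ∈ I
    · simpa [φ, h] using dist_le_pi_dist v w ⟨i, h⟩
    · simp [φ, h]
  calc dimH {z : ι → ℝ | ∀ j ∉ I, z j = 0} ≤ dimH (Set.range φ) := dimH_mono <| by
        intro z hz
        refine ⟨fun i => z i, funext fun i => ?_⟩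
        by_cases h : i ∈ I
        · simp [φ, h]
        · simp [φ, h, hz i h]
    _ ≤ dimH (Set.univ : Set (I → ℝ)) := hφ.dimH_range_le
    _ = I.card := by simp [Real.dimH_univ_pi]

/-- The total derivative of a polynomial function in terms of partial derivatives. -/
theorem MvPolynomial.hasStrictFDerivAt_aeval {ι R : Type*} [Fintype ι] [CommSemiring R]
    [Algebra R ℝ] (q : MvPolynomial ι R) (y : ι → ℝ) :
    HasStrictFDerivAt (fun x : ι → ℝ => MvPolynomial.aeval x q)
      (∑ i, MvPolynomial.aeval y (MvPolynomial.pderiv i q) •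
        (ContinuousLinearMap.proj i : (ι → ℝ) →L[ℝ] ℝ)) y := by
  classical
  induction q using MvPolynomial.induction_on with
  | C a => simpa using hasStrictFDerivAt_const (𝕜 := ℝ) _ y
  | add p q hp hq =>
    simp only [map_add]
    refine (hp.fun_add hq).congr_fderiv ?_
    simp only [add_smul, Finset.sum_add_distrib]
  | mul_X p j hp =>
    simp only [map_mul, MvPolynomial.aeval_X]
    refine (hp.fun_mul (hasStrictFDerivAt_apply (𝕜 := ℝ) j y)).congr_fderiv ?_
    simp only [MvPolynomial.pderiv_mul, MvPolynomial.pderiv_X, map_add, map_mul,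
      MvPolynomial.aeval_X, add_smul, Finset.sum_add_distrib, Finset.smul_sum, Pi.single_apply,
      apply_ite (MvPolynomial.aeval y), map_zero, mul_ite, mul_one, mul_zero, ite_smul,
      zero_smul, Finset.sum_ite_eq, Finset.mem_univ, if_true, smul_smul]
    rw [add_comm]
    simp only [mul_comm]

theorem MvPolynomial.notMem_vars_of_pderiv_eq_zero {ι R : Type*} [CommRing R] [CharZero R]
    [IsDomain R] {q : MvPolynomial ι R} {j : ι} (h : MvPolynomial.pderiv j q = 0) :
    j ∉ q.vars := by
  rw [MvPolynomial.mem_vars_iff_mem_support]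
  rintro ⟨m, hm, hj⟩
  have h1 := MvPolynomial.coeff_pderiv q (i := j) (m - Finsupp.single j 1)
  rw [h, MvPolynomial.coeff_zero, tsub_add_cancel_of_le] at h1
  · have h2 := MvPolynomial.mem_support_iff.1 hm
    have : ((m - Finsupp.single j 1 : ι →₀ ℕ) j : R) + 1 ≠ 0 := Nat.cast_add_one_ne_zero _
    exact mul_ne_zero h2 this h1.symm
  · rw [Finsupp.single_le_iff]
    exact Nat.one_le_iff_ne_zero.2 (Finsupp.mem_support_iff.1 hj)

/-- The map keeping the coordinates in `I` and replacing any other coordinate `j` by the value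
of the polynomial `q j`. -/
def triangularMap {ι R : Type*} [DecidableEq ι] [CommSemiring R] [Algebra R ℝ]
    (I : Finset ι) (q : ι → MvPolynomial ι R) (y : ι → ℝ) (i : ι) : ℝ :=
  MvPolynomial.aeval y (if i ∈ I then MvPolynomial.X i else q i)

theorem hasStrictFDerivAt_triangularMap {ι R : Type*} [Fintype ι] [DecidableEq ι]
    [CommSemiring R] [Algebra R ℝ] (I : Finset ι) (q : ι → MvPolynomial ι R)
    (hq : ∀ j ∉ I, (q j).vars ⊆ insert j I) {y : ι → ℝ}
    (hy : ∀ j ∉ I, MvPolynomial.aeval y (MvPolynomial.pderiv j (q j)) ≠ 0) :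
    ∃ A : (ι → ℝ) ≃L[ℝ] (ι → ℝ),
      HasStrictFDerivAt (triangularMap I q) (A : (ι → ℝ) →L[ℝ] (ι → ℝ)) y := by
  let r : ι → MvPolynomial ι R := fun i => if i ∈ I then MvPolynomial.X i else q i
  let G' : (ι → ℝ) →L[ℝ] (ι → ℝ) := ContinuousLinearMap.pi fun i =>
    ∑ k, MvPolynomial.aeval y (MvPolynomial.pderiv k (r i)) •
        (ContinuousLinearMap.proj k : (ι → ℝ) →L[ℝ] ℝ)
  have hG : HasStrictFDerivAt (triangularMap I q) G' y :=
    hasStrictFDerivAt_pi.2 fun i => MvPolynomial.hasStrictFDerivAt_aeval (r i) y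
  have hinj : Function.Injective G' := by
    refine (injective_iff_map_eq_zero G').2 fun v hv => ?_
    have hvi : ∀ i, ∑ k, MvPolynomial.aeval y (MvPolynomial.pderiv k (r i)) * v k = 0 := by
      intro i
      have := congrFun hv i
      simpa [G'] using this
    have hI : ∀ i ∈ I, v i = 0 := by
      intro i hi
      have := hvi i
      simpa [r, hi, MvPolynomial.pderiv_X, Pi.single_apply,
        apply_ite (MvPolynomial.aeval y)] using this
    refine funext fun j => ?_
    by_cases hj : j ∈ I
    · exact hI j hj
    · have h1 := hvi j
      rw [Finset.sum_eq_single j] at h1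
      · have : r j = q j := by simp [r, hj]
        rw [this] at h1
        exact (mul_eq_zero.1 h1).resolve_left (hy j hj)
      · intro k _ hkj
        by_cases hk : k ∈ I
        · rw [hI k hk, mul_zero]
        · have : k ∉ (r j).vars := by
            simp only [r, hj, if_false]
            intro hkq
            have := hq j hj hkq
            simp_all
          rw [MvPolynomial.pderiv_eq_zero_of_notMem_vars this, map_zero, zero_mul]
      · simp
  refine ⟨(LinearEquiv.ofInjectiveEndo (G' : (ι → ℝ) →ₗ[ℝ] (ι → ℝ))
    hinj).toContinuousLinearEquiv, ?_⟩
  convert hG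
  ext v : 1
  rfl

theorem dimH_stratum_le {ι R : Type*} [Fintype ι] [DecidableEq ι] [CommSemiring R] [Algebra R ℝ]
    (I : Finset ι) (q : ι → MvPolynomial ι R) (hq : ∀ j ∉ I, (q j).vars ⊆ insert j I) :
    dimH {y : ι → ℝ | ∀ j ∉ I, MvPolynomial.aeval y (q j) = 0 ∧
      MvPolynomial.aeval y (MvPolynomial.pderiv j (q j)) ≠ 0} ≤ I.card := by
  refine (dimH_le_dimH_image_of_hasStrictFDerivAt fun y hy =>
    hasStrictFDerivAt_triangularMap I q hq fun j hj => (hy j hj).2).trans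
    ((dimH_mono ?_).trans (dimH_coordinate_subspace_le I))
  rintro _ ⟨y, hy, rfl⟩ j hj
  simpa [triangularMap, hj] using (hy j hj).1

theorem MvPolynomial.add_single_mem_support_of_mem_support_pderiv {ι R : Type*} [CommSemiring R]
    {q : MvPolynomial ι R} {j : ι} {m : ι →₀ ℕ} (h : m ∈ (MvPolynomial.pderiv j q).support) :
    m + Finsupp.single j 1 ∈ q.support := by
  rw [MvPolynomial.mem_support_iff, MvPolynomial.coeff_pderiv] at h
  exact MvPolynomial.mem_support_iff.2 (left_ne_zero_of_mul h)

theorem MvPolynomial.vars_pderiv_subset {ι R : Type*} [CommSemiring R]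
    (q : MvPolynomial ι R) (j : ι) : (MvPolynomial.pderiv j q).vars ⊆ q.vars := by
  intro i hi
  rw [MvPolynomial.mem_vars_iff_mem_support] at hi ⊢
  obtain ⟨m, hm, him⟩ := hi
  refine ⟨_, MvPolynomial.add_single_mem_support_of_mem_support_pderiv hm, ?_⟩
  rw [Finsupp.mem_support_iff] at him ⊢
  rw [Finsupp.add_apply]
  omega

theorem MvPolynomial.totalDegree_pderiv_lt {ι R : Type*} [CommSemiring R]
    {q : MvPolynomial ι R} {j : ι} (h : MvPolynomial.pderiv j q ≠ 0) :
    (MvPolynomial.pderiv j q).totalDegree < q.totalDegree := by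
  have hlt : ∀ m ∈ (MvPolynomial.pderiv j q).support, (m.sum fun _ e => e) < q.totalDegree := by
    intro m hm
    have := MvPolynomial.le_totalDegree
      (MvPolynomial.add_single_mem_support_of_mem_support_pderiv hm)
    rw [Finsupp.sum_add_index' (fun _ => rfl) (fun _ _ _ => rfl),
      Finsupp.sum_single_index rfl] at this
    omega
  obtain ⟨m, hm⟩ := MvPolynomial.support_nonempty.2 h
  exact (Finset.sup_lt_iff ((Nat.zero_le _).trans_lt (hlt m hm))).2 hlt

theorem exists_separable_relation {ι F : Type*} [DecidableEq ι] [Field F] [CharZero F]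
    [Algebra F ℝ] {x : ι → ℝ} {I : Finset ι} {j : ι}
    (hI : AlgebraicIndependent F fun i : I => x i)
    (hIj : ¬ AlgebraicIndependent F fun i : (insert j I : Finset ι) => x i) :
    ∃ q : MvPolynomial ι F, q.vars ⊆ insert j I ∧ MvPolynomial.aeval x q = 0 ∧
      MvPolynomial.aeval x (MvPolynomial.pderiv j q) ≠ 0 := by
  classical
  have hex : ∃ N, ∃ q : MvPolynomial ι F, q ≠ 0 ∧ q.vars ⊆ insert j I ∧
      MvPolynomial.aeval x q = 0 ∧ q.totalDegree = N := by
    rw [algebraicIndependent_iff] at hIj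
    push Not at hIj
    obtain ⟨p, hp, hp0⟩ := hIj
    refine ⟨_, MvPolynomial.rename Subtype.val p, ?_, ?_, ?_, rfl⟩
    · exact fun h => hp0 ((map_eq_zero_iff _
        (MvPolynomial.rename_injective _ Subtype.val_injective)).1 h)
    · intro i hi
      obtain ⟨k, -, rfl⟩ := MvPolynomial.mem_vars_rename _ _ hi
      exact k.2
    · rw [MvPolynomial.aeval_rename]
      exact hp
  obtain ⟨q, hq0, hqv, hqx, hqN⟩ := Nat.find_spec hex
  refine ⟨q, hqv, hqx, fun hder => ?_⟩
  have hzero : MvPolynomial.pderiv j q = 0 := by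
    by_contra hne
    refine Nat.find_min hex (hqN ▸ MvPolynomial.totalDegree_pderiv_lt hne) ?_
    exact ⟨_, hne, (MvPolynomial.vars_pderiv_subset q j).trans hqv, hder, rfl⟩
  have hjq := MvPolynomial.notMem_vars_of_pderiv_eq_zero hzero
  have hqI : ∀ i ∈ q.vars, i ∈ I := fun i hi => by
    have := hqv hi
    rcases Finset.mem_insert.1 this with rfl | h
    · exact absurd hi hjq
    · exact h
  obtain ⟨p, rfl⟩ : ∃ p : MvPolynomial I F, MvPolynomial.rename Subtype.val p = q := by
    have := (MvPolynomial.mem_supported (R := F) (s := (I : Set ι)) (p := q)).2 (fun i hi => hqI i hi)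
    rw [MvPolynomial.supported_eq_range_rename] at this
    exact this
  rw [MvPolynomial.aeval_rename] at hqx
  refine hq0 ?_
  rw [algebraicIndependent_iff.1 hI p hqx, map_zero]

theorem dimH_le_of_algebraicIndependent_card_le {ι F : Type*} [Fintype ι] [Field F] [CharZero F]
    [Countable F] [Algebra F ℝ] {S : Set (ι → ℝ)} {d : ℕ}
    (h : ∀ x ∈ S, ∀ I : Finset ι, AlgebraicIndependent F (fun i : I => x i) → I.card ≤ d) :
    dimH S ≤ d := by
  classical
  have hcount : Countable (MvPolynomial ι F) := by
    rw [← Cardinal.mk_le_aleph0_iff]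
    refine MvPolynomial.cardinalMk_le_max_lift.trans ?_
    simp
  let T : {p : Finset ι × (ι → MvPolynomial ι F) //
      p.1.card ≤ d ∧ ∀ j ∉ p.1, (p.2 j).vars ⊆ insert j p.1} → Set (ι → ℝ) := fun p =>
    {y : ι → ℝ | ∀ j ∉ p.1.1, MvPolynomial.aeval y (p.1.2 j) = 0 ∧
      MvPolynomial.aeval y (MvPolynomial.pderiv j (p.1.2 j)) ≠ 0}
  have hST : S ⊆ ⋃ p, T p := by
    intro x hx
    obtain ⟨I, hI, hmax⟩ := (Set.toFinite
      {I : Finset ι | AlgebraicIndependent F (fun i : I => x i)}).exists_maximal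
        ⟨∅, algebraicIndependent_empty_type_iff.2 (algebraMap F ℝ).injective⟩
    have hrel : ∀ j, ∃ q : MvPolynomial ι F, j ∉ I → q.vars ⊆ insert j I ∧
        MvPolynomial.aeval x q = 0 ∧ MvPolynomial.aeval x (MvPolynomial.pderiv j q) ≠ 0 := by
      intro j
      by_cases hj : j ∈ I
      · exact ⟨0, fun h => absurd hj h⟩
      · obtain ⟨q, hq⟩ := exists_separable_relation hI (j := j) fun hIj =>
          hj (hmax hIj (Finset.subset_insert j I) (Finset.mem_insert_self j I))
        exact ⟨q, fun _ => hq⟩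
    choose q hq using hrel
    exact Set.mem_iUnion.2 ⟨⟨(I, q), h x hx I hI, fun j hj => (hq j hj).1⟩,
      fun j hj => (hq j hj).2⟩
  refine (dimH_mono hST).trans ?_
  rw [dimH_iUnion]
  refine iSup_le fun p => (dimH_stratum_le p.1.1 p.1.2 p.2.2).trans ?_
  exact_mod_cast p.2.1

/-- Polynomials in `m + 1` variables as univariate polynomials in the `j`-th variable. -/
def MvPolynomial.splitVariable (F : Type*) [CommSemiring F] {m : ℕ} (j : Fin (m + 1)) :
    MvPolynomial (Fin (m + 1)) F ≃ₐ[F] Polynomial (MvPolynomial (Fin m) F) :=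
  (MvPolynomial.renameEquiv F (finSuccEquiv' j)).trans (MvPolynomial.optionEquivLeft F (Fin m))

theorem MvPolynomial.aeval_eq_eval₂_splitVariable {F : Type*} [CommSemiring F] [Algebra F ℝ]
    {m : ℕ} (j : Fin (m + 1)) (x : Fin (m + 1) → ℝ) (g : MvPolynomial (Fin (m + 1)) F) :
    MvPolynomial.aeval x g =
      Polynomial.eval₂ (MvPolynomial.aeval fun i => x (j.succAbove i) :
        MvPolynomial (Fin m) F →ₐ[F] ℝ).toRingHom (x j) (MvPolynomial.splitVariable F j g) := by
  induction g using MvPolynomial.induction_on with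
  | C a => simp [MvPolynomial.splitVariable, MvPolynomial.algebraMap_eq]
  | add p q hp hq => rw [map_add, map_add, Polynomial.eval₂_add, hp, hq]
  | mul_X p i hp =>
    rw [map_mul, map_mul, Polynomial.eval₂_mul, hp]
    congr 1
    rcases Fin.eq_self_or_eq_succAbove j i with rfl | ⟨k, rfl⟩
    · simp [MvPolynomial.splitVariable]
    · simp [MvPolynomial.splitVariable]

/-- A point of a hypersurface of dimension `m` in `ℝ^(m+1)` with `m` independent coordinates. -/
theorem exists_algebraicIndependent_of_dimH_eq {F : Type*} [Field F] [CharZero F] [Countable F]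
    [Algebra F ℝ] {m : ℕ} {S : Set (Fin (m + 1) → ℝ)} (hne : S.Nonempty) (hS : dimH S = m) :
    ∃ x ∈ S, ∃ j : Fin (m + 1), AlgebraicIndependent F fun i : Fin m => x (j.succAbove i) := by
  rcases m with _ | k
  · obtain ⟨x, hx⟩ := hne
    exact ⟨x, hx, 0, algebraicIndependent_empty_type_iff.2 (algebraMap F ℝ).injective⟩
  · by_contra! hcon
    have hle : dimH S ≤ k := dimH_le_of_algebraicIndependent_card_le (F := F) fun x hx I hI => by
      by_contra! hcard
      obtain ⟨j, hj⟩ : ∃ j : Fin (k + 2), ∀ i, i ≠ j → i ∈ I := by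
        have hc : Iᶜ.card ≤ 1 := by
          rw [Finset.card_compl, Fintype.card_fin]
          omega
        rw [Finset.card_le_one] at hc
        by_cases hI' : Iᶜ = ∅
        · exact ⟨0, fun i _ => by simpa using (Finset.ext_iff.1 hI' i)⟩
        · obtain ⟨j, hj⟩ := Finset.nonempty_iff_ne_empty.2 hI'
          refine ⟨j, fun i hij => by_contra fun hi => hij (hc i (by simpa using hi) j hj)⟩
      refine hcon x hx j ?_
      exact hI.comp (fun i : Fin (k + 1) => ⟨j.succAbove i, hj _ (j.succAbove_ne i)⟩)
        fun a b hab => j.succAbove_right_injective (congrArg Subtype.val hab)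
    rw [hS] at hle
    have : k + 1 ≤ k := by exact_mod_cast hle
    omega

theorem dvd_of_aeval_eq_zero_of_algebraicIndependent {F : Type*} [Field F] [Algebra F ℝ] {m : ℕ}
    {x : Fin (m + 1) → ℝ} {j : Fin (m + 1)}
    (hx : AlgebraicIndependent F fun i : Fin m => x (j.succAbove i))
    {f g : MvPolynomial (Fin (m + 1)) F} (hf : Irreducible f) (hfx : MvPolynomial.aeval x f = 0)
    (hgx : MvPolynomial.aeval x g = 0) : f ∣ g := by
  let A := MvPolynomial (Fin m) F
  let L := FractionRing A
  let e := MvPolynomial.splitVariable F j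
  let φ : A →+* ℝ := (MvPolynomial.aeval fun i => x (j.succAbove i) : A →ₐ[F] ℝ).toRingHom
  have hφ : Function.Injective φ := hx
  let ψ : L →+* ℝ := IsFractionRing.lift hφ
  have hψ : ψ.comp (algebraMap A L) = φ := by
    ext <;> simp [ψ]
  have hev : ∀ h, MvPolynomial.aeval x h =
      Polynomial.eval₂ ψ (x j) ((e h).map (algebraMap A L)) := fun h => by
    rw [Polynomial.eval₂_map, hψ]
    exact MvPolynomial.aeval_eq_eval₂_splitVariable j x h
  let _ : NormalizedGCDMonoid A := Classical.choice inferInstance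
  have hirr : Irreducible (e f) := (MulEquiv.irreducible_iff e.toMulEquiv).2 hf
  have hdeg : (e f).natDegree ≠ 0 := by
    intro h0
    rw [Polynomial.natDegree_eq_zero] at h0
    obtain ⟨a, ha⟩ := h0
    rw [hev, ← ha, Polynomial.map_C, Polynomial.eval₂_C] at hfx
    have : a = 0 := by
      refine hφ ?_
      rw [map_zero, ← hfx, ← hψ]
      rfl
    rw [this, map_zero] at ha
    exact hirr.ne_zero ha.symm
  have hprim := hirr.isPrimitive hdeg
  have hirrL := (hprim.irreducible_iff_irreducible_map_fraction_map (K := L)).1 hirr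
  rcases hirrL.isCoprime_or_dvd ((e g).map (algebraMap A L)) with hco | hdvd
  · obtain ⟨a, b, hab⟩ := hco
    have := congrArg (Polynomial.eval₂ ψ (x j)) hab
    rw [Polynomial.eval₂_add, Polynomial.eval₂_mul, Polynomial.eval₂_mul, ← hev, ← hev, hfx, hgx,
      mul_zero, mul_zero, add_zero, Polynomial.eval₂_one] at this
    exact absurd this zero_ne_one
  · exact (map_dvd_iff e).1 (hprim.dvd_of_fraction_map_dvd_fraction_map hdvd)

theorem MvPolynomial.exists_rename_succAbove {F : Type*} [CommSemiring F] {m : ℕ}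
    {f : MvPolynomial (Fin (m + 1)) F} {j : Fin (m + 1)} (hj : j ∉ f.vars) :
    ∃ p : MvPolynomial (Fin m) F, MvPolynomial.rename j.succAbove p = f := by
  refine MvPolynomial.exists_rename_eq_of_vars_subset_range f _ j.succAbove_right_injective ?_
  rw [Fin.range_succAbove]
  intro i hi
  rintro rfl
  exact hj hi

theorem aeval_pderiv_ne_zero_of_algebraicIndependent {F : Type*} [Field F] [CharZero F]
    [Algebra F ℝ] {m : ℕ} {x : Fin (m + 1) → ℝ} {j : Fin (m + 1)}
    (hx : AlgebraicIndependent F fun i : Fin m => x (j.succAbove i))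
    {f : MvPolynomial (Fin (m + 1)) F} (hf : Irreducible f) (hfx : MvPolynomial.aeval x f = 0) :
    MvPolynomial.aeval x (MvPolynomial.pderiv j f) ≠ 0 := by
  intro hder
  by_cases h0 : MvPolynomial.pderiv j f = 0
  · obtain ⟨p, rfl⟩ := MvPolynomial.exists_rename_succAbove
      (MvPolynomial.notMem_vars_of_pderiv_eq_zero h0)
    rw [MvPolynomial.aeval_rename] at hfx
    refine hf.ne_zero ?_
    rw [algebraicIndependent_iff.1 hx p hfx, map_zero]
  · obtain ⟨c, hc⟩ := dvd_of_aeval_eq_zero_of_algebraicIndependent hx hf hfx hder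
    have hlt := MvPolynomial.totalDegree_pderiv_lt h0
    have hc0 : c ≠ 0 := by
      rintro rfl
      exact h0 (by rw [hc, mul_zero])
    rw [hc, MvPolynomial.totalDegree_mul_of_isDomain hf.ne_zero hc0] at hlt
    omega

theorem MvPolynomial.isAlgebraic_aeval {F ι : Type*} [CommRing F] [Algebra F ℝ]
    (hF : ∀ a : F, IsAlgebraic ℚ (algebraMap F ℝ a)) {y : ι → ℝ} (hy : ∀ i, IsAlgebraic ℚ (y i))
    (p : MvPolynomial ι F) : IsAlgebraic ℚ (MvPolynomial.aeval y p) := by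
  induction p using MvPolynomial.induction_on with
  | C a => simpa using hF a
  | add p q hp hq => simpa using hp.add hq
  | mul_X p i hp => simpa using hp.mul (hy i)

theorem Polynomial.isAlgebraic_of_coeff_isAlgebraic {q : Polynomial ℝ} (hq : q ≠ 0)
    (hcoeff : ∀ n, IsAlgebraic ℚ (q.coeff n)) {t : ℝ} (ht : q.eval t = 0) : IsAlgebraic ℚ t := by
  have hlift : q ∈ Polynomial.lifts (algebraMap (algebraicClosure ℚ ℝ) ℝ) :=
    (Polynomial.lifts_iff_coeff_lifts _).2 fun n =>
      ⟨⟨q.coeff n, mem_algebraicClosure_iff.2 (hcoeff n)⟩, rfl⟩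
  obtain ⟨q', rfl⟩ := (Polynomial.mem_lifts _).1 hlift
  have halg : IsAlgebraic (algebraicClosure ℚ ℝ) t :=
    ⟨q', fun h => hq (by rw [h, Polynomial.map_zero]), by
      rwa [Polynomial.aeval_def, ← Polynomial.eval_map]⟩
  have : Algebra.IsAlgebraic ℚ (algebraicClosure ℚ ℝ) := ⟨fun a =>
    (isAlgebraic_algebraMap_iff (algebraMap (algebraicClosure ℚ ℝ) ℝ).injective).1
      (mem_algebraicClosure_iff.1 a.2)⟩
  exact halg.restrictScalars ℚ

/-- Algebraic points are dense in a real hypersurface near a generic point, hence detect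
divisibility by its equation. -/
theorem dvd_of_aeval_eq_zero_on_algebraic_points {F : Type*} [Field F] [CharZero F]
    [Algebra F ℝ] (hF : ∀ a : F, IsAlgebraic ℚ (algebraMap F ℝ a)) {m : ℕ}
    {x : Fin (m + 1) → ℝ} {j : Fin (m + 1)}
    (hx : AlgebraicIndependent F fun i : Fin m => x (j.succAbove i))
    {f g : MvPolynomial (Fin (m + 1)) F} (hf : Irreducible f) (hfx : MvPolynomial.aeval x f = 0)
    (hg : ∀ y : Fin (m + 1) → ℝ, (∀ i, IsAlgebraic ℚ (y i)) → MvPolynomial.aeval y f = 0 →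
      MvPolynomial.aeval y g = 0) : f ∣ g := by
  refine dvd_of_aeval_eq_zero_of_algebraicIndependent hx hf hfx (by_contra fun hgx => ?_)
  let I : Finset (Fin (m + 1)) := Finset.univ.erase j
  let c := (MvPolynomial.splitVariable F j f).leadingCoeff
  have hc : MvPolynomial.aeval (fun i => x (j.succAbove i)) c ≠ 0 := fun h => by
    have := algebraicIndependent_iff.1 hx c h
    rw [Polynomial.leadingCoeff_eq_zero, map_eq_zero_iff _ (AlgEquiv.injective _)] at this
    exact hf.ne_zero this
  obtain ⟨A, hA⟩ := hasStrictFDerivAt_triangularMap I (fun _ => f) (y := x)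
    (fun k hk i _ => by
      have hkj : k = j := by simpa [I] using hk
      rw [hkj]
      by_cases hi : i = j <;> simp [I, hi])
    (fun k hk => by
      have hkj : k = j := by simpa [I] using hk
      rw [hkj]
      exact aeval_pderiv_ne_zero_of_algebraicIndependent hx hf hfx)
  have hcont : ∀ {k : ℕ} (p : MvPolynomial (Fin k) F),
      Continuous fun y : Fin k → ℝ => MvPolynomial.aeval y p := fun p =>
    continuous_iff_continuousAt.2 fun y => (MvPolynomial.hasStrictFDerivAt_aeval p y).continuousAt
  have hU : {y : Fin (m + 1) → ℝ | MvPolynomial.aeval y g ≠ 0 ∧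
      MvPolynomial.aeval (fun i => y (j.succAbove i)) c ≠ 0} ∈ nhds x := by
    refine IsOpen.mem_nhds (IsOpen.inter ?_ ?_) ⟨hgx, hc⟩
    · exact isOpen_ne_fun (hcont g) continuous_const
    · exact isOpen_ne_fun ((hcont c).comp (by fun_prop)) continuous_const
  have hGU := Filter.image_mem_map (m := triangularMap I fun _ => f) hU
  rw [hA.map_nhds_eq_of_equiv] at hGU
  let ins : (Fin m → ℝ) → Fin (m + 1) → ℝ := fun w => j.insertNth (α := fun _ => ℝ) 0 w
  have hins : Continuous ins := by
    refine continuous_pi fun i => ?_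
    rcases Fin.eq_self_or_eq_succAbove j i with rfl | ⟨k, rfl⟩
    · simpa [ins] using continuous_const
    · simpa [ins] using continuous_apply k
  have hGx : ins (fun i => x (j.succAbove i)) = triangularMap I (fun _ => f) x := by
    funext i
    rcases Fin.eq_self_or_eq_succAbove j i with rfl | ⟨k, rfl⟩
    · simp [ins, triangularMap, I, hfx]
    · simp [ins, triangularMap, I, Fin.succAbove_ne]
  rw [← hGx] at hGU
  have hdense : Dense (Set.pi Set.univ fun _ : Fin m => Set.range ((↑) : ℚ → ℝ)) :=
    dense_pi _ fun _ _ => Rat.denseRange_cast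
  obtain ⟨w, hw, hwD⟩ := hdense.inter_nhds_nonempty (hins.continuousAt.preimage_mem_nhds hGU)
  obtain ⟨y, ⟨hyg, hyc⟩, hyw⟩ := hwD
  have hyj : MvPolynomial.aeval y f = 0 := by
    have := congrFun hyw j
    simpa [ins, triangularMap, I] using this
  have hyk : ∀ k, IsAlgebraic ℚ (y (j.succAbove k)) := fun k => by
    have h1 := congrFun hyw (j.succAbove k)
    obtain ⟨a, ha⟩ := hw k (Set.mem_univ k)
    have h2 : y (j.succAbove k) = (a : ℝ) := by
      rw [ha]
      simpa [ins, triangularMap, I, Fin.succAbove_ne] using h1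
    rw [h2]
    exact isAlgebraic_algebraMap (R := ℚ) (A := ℝ) a
  refine hyg (hg y (fun i => ?_) hyj)
  rcases Fin.eq_self_or_eq_succAbove j i with rfl | ⟨k, rfl⟩
  · rw [MvPolynomial.aeval_eq_eval₂_splitVariable i y f, ← Polynomial.eval_map] at hyj
    refine Polynomial.isAlgebraic_of_coeff_isAlgebraic (fun h0 => hyc ?_) (fun n => ?_) hyj
    · have := congrArg (Polynomial.coeff · (MvPolynomial.splitVariable F i f).natDegree) h0
      simpa [Polynomial.coeff_map] using this
    · rw [Polynomial.coeff_map]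
      exact MvPolynomial.isAlgebraic_aeval hF hyk _
  · exact hyk k

section AlgebraicSets

variable {σ : Type*} {K : Subfield ℝ}

theorem exists_map_eq_of_coeffsIn {P : MvPolynomial σ ℝ} (hP : CoeffsIn K P) :
    ∃ p : MvPolynomial σ K, MvPolynomial.map (algebraMap K ℝ) p = P := by
  refine MvPolynomial.mem_range_map_iff_coeffs_subset.2 ?_
  intro c hc
  obtain ⟨d, -, rfl⟩ := MvPolynomial.mem_coeffs_iff.1 hc
  exact ⟨⟨_, hP d⟩, rfl⟩

theorem isAlgSet_iff {S : Set (σ → ℝ)} :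
    IsAlgSet K S ↔ ∃ p : MvPolynomial σ K, S = {x | MvPolynomial.aeval x p = 0} := by
  constructor
  · rintro ⟨P, hP, rfl⟩
    obtain ⟨p, rfl⟩ := exists_map_eq_of_coeffsIn hP
    exact ⟨p, by simp [MvPolynomial.eval_map, MvPolynomial.aeval_def]⟩
  · rintro ⟨p, rfl⟩
    refine ⟨MvPolynomial.map (algebraMap K ℝ) p, fun d => ?_, ?_⟩
    · rw [MvPolynomial.coeff_map]
      exact (p.coeff d).2
    · simp [MvPolynomial.eval_map, MvPolynomial.aeval_def]

theorem IsAlgSet.inter {S T : Set (σ → ℝ)} (hS : IsAlgSet K S) (hT : IsAlgSet K T) :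
    IsAlgSet K (S ∩ T) := by
  obtain ⟨p, rfl⟩ := isAlgSet_iff.1 hS
  obtain ⟨q, rfl⟩ := isAlgSet_iff.1 hT
  refine isAlgSet_iff.2 ⟨p ^ 2 + q ^ 2, ?_⟩
  ext x
  simp only [mem_inter_iff, mem_ofPred_eq, map_add, map_pow]
  constructor
  · rintro ⟨h1, h2⟩
    simp [h1, h2]
  · intro h
    constructor <;> nlinarith [sq_nonneg (MvPolynomial.aeval x p),
      sq_nonneg (MvPolynomial.aeval x q)]

theorem IsIrredAlgSet.aeval_eq_zero_or {V : Set (σ → ℝ)} (hV : IsIrredAlgSet K V)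
    {a b : MvPolynomial σ K} (hab : ∀ x ∈ V, MvPolynomial.aeval x (a * b) = 0) :
    (∀ x ∈ V, MvPolynomial.aeval x a = 0) ∨ ∀ x ∈ V, MvPolynomial.aeval x b = 0 := by
  by_contra! h
  obtain ⟨⟨x, hxV, hxa⟩, y, hyV, hyb⟩ := h
  refine hV.2.2 ⟨V ∩ {x | MvPolynomial.aeval x a = 0}, V ∩ {x | MvPolynomial.aeval x b = 0},
    hV.1.inter (isAlgSet_iff.2 ⟨a, rfl⟩), hV.1.inter (isAlgSet_iff.2 ⟨b, rfl⟩), ?_,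
    ⟨inter_subset_left, fun h => hxa (h hxV).2⟩, ⟨inter_subset_left, fun h => hyb (h hyV).2⟩⟩
  rw [← inter_union_distrib_left, eq_comm, inter_eq_left]
  intro z hz
  simpa using hab z hz

theorem IsIrredAlgSet.exists_irreducible_dvd {V : Set (σ → ℝ)} (hV : IsIrredAlgSet K V)
    {q : MvPolynomial σ K} (hq : q ≠ 0) (hVq : ∀ x ∈ V, MvPolynomial.aeval x q = 0) :
    ∃ f, Irreducible f ∧ f ∣ q ∧ ∀ x ∈ V, MvPolynomial.aeval x f = 0 := by
  induction q using WfDvdMonoid.induction_on_irreducible with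
  | zero => exact absurd rfl hq
  | unit u hu =>
    obtain ⟨x, hx⟩ := hV.2.1
    exact absurd (hVq x hx) (hu.map (MvPolynomial.aeval x)).ne_zero
  | mul a i ha hi ih =>
    rcases hV.aeval_eq_zero_or hVq with h | h
    · exact ⟨i, hi, dvd_mul_right _ _, h⟩
    · obtain ⟨f, hf, hfa, hfV⟩ := ih ha h
      exact ⟨f, hf, hfa.mul_left _, hfV⟩

theorem IsIrredAlgSet.exists_irreducible_eq {V : Set (σ → ℝ)} (hV : IsIrredAlgSet K V)
    (hVu : V ≠ univ) :
    ∃ f : MvPolynomial σ K, Irreducible f ∧ V = {x | MvPolynomial.aeval x f = 0} := by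
  obtain ⟨q, hq⟩ := isAlgSet_iff.1 hV.1
  have hq0 : q ≠ 0 := by
    rintro rfl
    exact hVu (by simpa using hq)
  obtain ⟨f, hf, ⟨c, hc⟩, hfV⟩ := hV.exists_irreducible_dvd hq0 (fun x hx => by rwa [hq] at hx)
  refine ⟨f, hf, Subset.antisymm hfV fun x hx => ?_⟩
  rw [hq, mem_ofPred_eq, hc, map_mul, show MvPolynomial.aeval x f = 0 from hx, zero_mul]

theorem MvPolynomial.eq_zero_of_forall_aeval_eq_zero {q : MvPolynomial σ K}
    (h : ∀ x : σ → ℝ, MvPolynomial.aeval x q = 0) : q = 0 := by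
  apply MvPolynomial.map_injective (algebraMap K ℝ) (algebraMap K ℝ).injective
  refine MvPolynomial.funext fun x => ?_
  rw [MvPolynomial.eval_map, ← MvPolynomial.aeval_def, h, map_zero, map_zero]

theorem RealAlgExt.countable (hK : RealAlgExt K) : Countable K := by
  have : Countable {x : ℝ | IsAlgebraic ℚ x} := (Algebraic.countable ℚ ℝ).to_subtype
  exact Function.Injective.countable (f := fun a : K => (⟨a, hK a⟩ : {x : ℝ | IsAlgebraic ℚ x}))
    fun a b h => Subtype.ext (congrArg (Subtype.val (p := (· ∈ {x : ℝ | IsAlgebraic ℚ x}))) h)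

theorem ne_univ_of_dimH_eq {m : ℕ} {V : Set (Fin (m + 1) → ℝ)} (hdim : dimH V = m) :
    V ≠ univ := by
  rintro rfl
  rw [Real.dimH_univ_pi_fin] at hdim
  have : m + 1 = m := by exact_mod_cast hdim
  omega

theorem IsIrredAlgSet.exists_irreducible_dvd_of_dimH_eq {m : ℕ} (hK : RealAlgExt K)
    {V : Set (Fin (m + 1) → ℝ)} (hV : IsIrredAlgSet K V) (hdim : dimH V = m) :
    ∃ f : MvPolynomial (Fin (m + 1)) K, Irreducible f ∧
      V = {x | MvPolynomial.aeval x f = 0} ∧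
      ∀ g : MvPolynomial (Fin (m + 1)) K,
        (∀ y ∈ V, (∀ i, IsAlgebraic ℚ (y i)) → MvPolynomial.aeval y g = 0) → f ∣ g := by
  have := hK.countable
  obtain ⟨f, hf, hVf⟩ := hV.exists_irreducible_eq (ne_univ_of_dimH_eq hdim)
  obtain ⟨x, hx, j, hxj⟩ := exists_algebraicIndependent_of_dimH_eq (F := K) hV.2.1 hdim
  refine ⟨f, hf, hVf, fun g hg => ?_⟩
  refine dvd_of_aeval_eq_zero_on_algebraic_points hK hxj hf ?_ fun y hy hyf => ?_
  · rwa [hVf] at hx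
  · exact hg y (by rw [hVf]; exact hyf) hy

end AlgebraicSets

section SumVariables

variable {X U R : Type*} [CommRing R]

/-- Polynomials in two groups of variables, seen as polynomials in the second group whose
coefficients are polynomials in the first. -/
def MvPolynomial.sumAlgEquivRight (X U R : Type*) [CommRing R] :
    MvPolynomial (X ⊕ U) R ≃ₐ[R] MvPolynomial U (MvPolynomial X R) :=
  (MvPolynomial.renameEquiv R (Equiv.sumComm X U)).trans (MvPolynomial.sumAlgEquiv R U X)

theorem MvPolynomial.sumAlgEquivRight_X_inl (i : X) :
    MvPolynomial.sumAlgEquivRight X U R (MvPolynomial.X (Sum.inl i)) =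
      MvPolynomial.C (MvPolynomial.X i) := by
  simp [MvPolynomial.sumAlgEquivRight]

theorem MvPolynomial.sumAlgEquivRight_X_inr (i : U) :
    MvPolynomial.sumAlgEquivRight X U R (MvPolynomial.X (Sum.inr i)) = MvPolynomial.X i := by
  simp [MvPolynomial.sumAlgEquivRight]

theorem MvPolynomial.sumAlgEquivRight_C (r : R) :
    MvPolynomial.sumAlgEquivRight X U R (MvPolynomial.C r) =
      MvPolynomial.C (MvPolynomial.C r) :=
  (MvPolynomial.sumAlgEquivRight X U R).commutes r

theorem MvPolynomial.sumAlgEquivRight_rename_inl (g : MvPolynomial X R) :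
    MvPolynomial.sumAlgEquivRight X U R (MvPolynomial.rename Sum.inl g) =
      MvPolynomial.C g := by
  induction g using MvPolynomial.induction_on with
  | C a => rw [MvPolynomial.rename_C, MvPolynomial.sumAlgEquivRight_C]
  | add p q hp hq => rw [map_add, map_add, hp, hq, map_add]
  | mul_X p i hp =>
    rw [map_mul, map_mul, hp, MvPolynomial.rename_X, MvPolynomial.sumAlgEquivRight_X_inl, map_mul]

theorem MvPolynomial.aeval_eq_eval₂_sumAlgEquivRight {A : Type*} [CommRing A] [Algebra R A]
    (z : X ⊕ U → A) (h : MvPolynomial (X ⊕ U) R) :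
    MvPolynomial.aeval z h =
      MvPolynomial.eval₂ (MvPolynomial.aeval fun i => z (Sum.inl i) : MvPolynomial X R →ₐ[R] A)
        (fun i => z (Sum.inr i)) (MvPolynomial.sumAlgEquivRight X U R h) := by
  induction h using MvPolynomial.induction_on with
  | C a => simp [MvPolynomial.sumAlgEquivRight_C]
  | add p q hp hq => rw [map_add, map_add, hp, hq, MvPolynomial.eval₂_add]
  | mul_X p i hp =>
    rw [map_mul, map_mul, hp, MvPolynomial.eval₂_mul]
    rcases i with i | i
    · simp [MvPolynomial.sumAlgEquivRight_X_inl]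
    · simp [MvPolynomial.sumAlgEquivRight_X_inr]

theorem MvPolynomial.sumAlgEquivRight_monomial (m : X ⊕ U →₀ ℕ) (a : R) :
    MvPolynomial.sumAlgEquivRight X U R (MvPolynomial.monomial m a) =
        MvPolynomial.monomial (m.comapDomain Sum.inr Sum.inr_injective.injOn)
          (MvPolynomial.monomial (m.comapDomain Sum.inl Sum.inl_injective.injOn) a) := by
  classical
  induction m using Finsupp.induction_linear generalizing a with
  | zero =>
    rw [Finsupp.comapDomain_zero, Finsupp.comapDomain_zero]
    exact MvPolynomial.sumAlgEquivRight_C a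
  | add f g hf hg =>
    have h1 := congrArg₂ (· * ·) (hf a) (hg 1)
    simp only [← map_mul, MvPolynomial.monomial_mul, mul_one] at h1
    rw [h1, Finsupp.comapDomain_add_of_injective Sum.inr_injective,
      Finsupp.comapDomain_add_of_injective Sum.inl_injective]
  | single i k =>
    rw [← MvPolynomial.C_mul_X_pow_eq_monomial, map_mul, map_pow, MvPolynomial.sumAlgEquivRight_C]
    rcases i with i | i
    · rw [MvPolynomial.sumAlgEquivRight_X_inl, Finsupp.comapDomain_single,
        ← map_pow, ← map_mul, MvPolynomial.C_mul_X_pow_eq_monomial]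
      have : (Finsupp.single (Sum.inl i : X ⊕ U) k).comapDomain Sum.inr
          Sum.inr_injective.injOn = 0 := by
        ext j
        simp
      rw [this]
      rfl
    · rw [MvPolynomial.sumAlgEquivRight_X_inr, Finsupp.comapDomain_single,
        MvPolynomial.C_mul_X_pow_eq_monomial]
      have : (Finsupp.single (Sum.inr i : X ⊕ U) k).comapDomain Sum.inl
          Sum.inl_injective.injOn = 0 := by
        ext j
        simp
      rw [this]
      rfl

theorem MvPolynomial.exists_mem_support_of_mem_support_sumAlgEquivRight
    {h : MvPolynomial (X ⊕ U) R} {d : U →₀ ℕ}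
    (hd : d ∈ (MvPolynomial.sumAlgEquivRight X U R h).support) :
    ∃ m ∈ h.support, ∀ i, m (Sum.inr i) = d i := by
  classical
  by_contra! hne
  have key : ∀ m : X ⊕ U →₀ ℕ, ∀ a : R, (∃ i, m (Sum.inr i) ≠ d i) →
      (MvPolynomial.sumAlgEquivRight X U R (MvPolynomial.monomial m a)).coeff d = 0 := by
    rintro m a ⟨i, hi⟩
    rw [MvPolynomial.sumAlgEquivRight_monomial, MvPolynomial.coeff_monomial, if_neg]
    rintro rfl
    exact hi rfl
  rw [MvPolynomial.mem_support_iff] at hd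
  refine hd ?_
  rw [h.as_sum, map_sum, MvPolynomial.coeff_sum]
  exact Finset.sum_eq_zero fun m hm => key m _ (hne m hm)

theorem MvPolynomial.rename_inl_dvd_iff {g : MvPolynomial X R} {h : MvPolynomial (X ⊕ U) R} :
    MvPolynomial.rename Sum.inl g ∣ h ↔
      ∀ d, g ∣ (MvPolynomial.sumAlgEquivRight X U R h).coeff d := by
  rw [← map_dvd_iff (MvPolynomial.sumAlgEquivRight X U R),
    MvPolynomial.sumAlgEquivRight_rename_inl, MvPolynomial.C_dvd_iff_dvd_coeff]

theorem MvPolynomial.prime_rename_inl {g : MvPolynomial X R} (hg : Prime g) :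
    Prime (MvPolynomial.rename (Sum.inl : X → X ⊕ U) g) := by
  rw [← MulEquiv.prime_iff (MvPolynomial.sumAlgEquivRight X U R).toMulEquiv]
  change Prime (MvPolynomial.sumAlgEquivRight X U R _)
  rw [MvPolynomial.sumAlgEquivRight_rename_inl]
  exact (MvPolynomial.prime_C_iff U).2 hg

end SumVariables

section ExponentialPolynomials

variable {K : Subfield ℝ} {n : ℕ}

/-- The linear form `∑ (dᵢ - eᵢ) Xᵢ`. -/
def MvPolynomial.expDiff (K : Subfield ℝ) (d e : Fin n →₀ ℕ) : MvPolynomial (Fin n) K :=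
  ∑ i, MvPolynomial.C ((d i : K) - e i) * MvPolynomial.X i

theorem MvPolynomial.aeval_expDiff (d e : Fin n →₀ ℕ) (x : Fin n → ℝ) :
    MvPolynomial.aeval x (MvPolynomial.expDiff K d e) =
      ∑ i, (d i : ℝ) * x i - ∑ i, (e i : ℝ) * x i := by
  rw [MvPolynomial.expDiff, map_sum, ← Finset.sum_sub_distrib]
  refine Finset.sum_congr rfl fun i _ => ?_
  rw [map_mul, MvPolynomial.aeval_X, MvPolynomial.aeval_C, map_sub, map_natCast, map_natCast,
    sub_mul]

theorem MvPolynomial.totalDegree_expDiff_le (d e : Fin n →₀ ℕ) :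
    (MvPolynomial.expDiff K d e).totalDegree ≤ 1 := by
  refine MvPolynomial.totalDegree_finsetSum_le fun i _ => ?_
  refine (MvPolynomial.totalDegree_mul _ _).trans ?_
  rw [MvPolynomial.totalDegree_C, MvPolynomial.totalDegree_X]

theorem MvPolynomial.expDiff_ne_zero {d e : Fin n →₀ ℕ} (hde : d ≠ e) :
    MvPolynomial.expDiff K d e ≠ 0 := by
  obtain ⟨i, hi⟩ := Finsupp.ne_iff.1 hde
  intro h
  have := MvPolynomial.aeval_expDiff (K := K) d e (Pi.single i 1)
  rw [h, map_zero] at this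
  simp [Pi.single_apply] at this
  exact hi (by exact_mod_cast (sub_eq_zero.1 this.symm))

theorem MvPolynomial.aeval_coeff_eq_zero_of_exp (hK : RealAlgExt K)
    (Q : MvPolynomial (Fin n) (MvPolynomial (Fin n) K)) {y : Fin n → ℝ}
    (hy : ∀ i, IsAlgebraic ℚ (y i))
    (hQ : MvPolynomial.eval₂ (MvPolynomial.aeval y : MvPolynomial (Fin n) K →ₐ[K] ℝ)
      (fun i => Real.exp (y i)) Q = 0)
    (hne : ∀ d ∈ Q.support, ∀ e ∈ Q.support, d ≠ e →
      MvPolynomial.aeval y (MvPolynomial.expDiff K d e) ≠ 0) (d : Fin n →₀ ℕ) :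
    MvPolynomial.aeval y (Q.coeff d) = 0 := by
  by_cases hd : d ∈ Q.support
  swap
  · rw [MvPolynomial.notMem_support_iff.1 hd, map_zero]
  have hcast : ∀ {r : ℝ}, IsAlgebraic ℚ r → IsAlgebraic ℚ (r : ℂ) := fun h =>
    h.algebraMap (A := ℂ)
  have h := lindemann_weierstrass Q.support
    (fun d => ((∑ i, (d i : ℝ) * y i : ℝ) : ℂ))
    (fun d => ((MvPolynomial.aeval y (Q.coeff d) : ℝ) : ℂ))
    (fun d _ => hcast ?_) (fun d _ => hcast (MvPolynomial.isAlgebraic_aeval hK hy _))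
    (fun d hd e he hde => ?_) ?_ d hd
  · exact_mod_cast h
  · exact isAlgebraic_iff_isIntegral.2 (IsIntegral.sum _ fun i _ =>
      isAlgebraic_iff_isIntegral.1 ((isAlgebraic_natCast _).mul (hy i)))
  · by_contra hne'
    refine hne d hd e he hne' ?_
    rw [MvPolynomial.aeval_expDiff, sub_eq_zero]
    exact Complex.ofReal_injective hde
  · rw [MvPolynomial.eval₂_eq'] at hQ
    rw [← Complex.ofReal_zero, ← hQ, Complex.ofReal_sum]
    refine Finset.sum_congr rfl fun d _ => ?_
    rw [Complex.ofReal_mul, ← Complex.ofReal_exp, Real.exp_sum]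
    simp only [Real.exp_nat_mul]
    rfl

theorem MvPolynomial.zeroSet_eq_of_dvd_expDiff {f : MvPolynomial (Fin n) K} (hf : Irreducible f)
    {d e : Fin n →₀ ℕ} (hde : d ≠ e) (h : f ∣ MvPolynomial.expDiff K d e) :
    {x : Fin n → ℝ | MvPolynomial.aeval x f = 0} =
      {x : Fin n → ℝ | ∑ i, (d i : ℝ) * x i = ∑ i, (e i : ℝ) * x i} := by
  obtain ⟨c, hc⟩ := h
  have h0 := MvPolynomial.expDiff_ne_zero (K := K) hde
  have hc0 : c ≠ 0 := by
    rintro rfl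
    exact h0 (by simpa using hc)
  have hdeg := MvPolynomial.totalDegree_expDiff_le (K := K) d e
  rw [hc, MvPolynomial.totalDegree_mul_of_isDomain hf.ne_zero hc0] at hdeg
  have hfdeg : f.totalDegree ≠ 0 := fun h1 => by
    rw [MvPolynomial.totalDegree_eq_zero_iff_eq_C] at h1
    refine hf.not_isUnit ?_
    rw [h1]
    refine (IsUnit.mk0 _ fun h2 => hf.ne_zero ?_).map MvPolynomial.C
    rw [h1, h2, map_zero]
  have hcdeg : c.totalDegree = 0 := by omega
  rw [MvPolynomial.totalDegree_eq_zero_iff_eq_C] at hcdeg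
  ext x
  have hx := MvPolynomial.aeval_expDiff (K := K) d e x
  rw [hc, map_mul, hcdeg, MvPolynomial.aeval_C] at hx
  have hcc : algebraMap K ℝ (c.coeff 0) ≠ 0 := by
    rw [map_ne_zero]
    intro h2
    exact hc0 (by rw [hcdeg, h2, map_zero])
  rw [mem_ofPred_eq, mem_ofPred_eq, ← sub_eq_zero (a := ∑ i, (d i : ℝ) * x i), ← hx,
    mul_eq_zero, or_iff_left hcc]

end ExponentialPolynomials

section Cylinders

variable {X U : Type*} {K : Subfield ℝ}

theorem MvPolynomial.rename_inl_dvd_of_forall {f : MvPolynomial X K} {V : Set (X → ℝ)}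
    (hV : ∀ g : MvPolynomial X K, (∀ y ∈ V, MvPolynomial.aeval y g = 0) → f ∣ g)
    {h : MvPolynomial (X ⊕ U) K}
    (hh : ∀ z : X ⊕ U → ℝ, (fun i => z (Sum.inl i)) ∈ V → MvPolynomial.aeval z h = 0) :
    MvPolynomial.rename Sum.inl f ∣ h := by
  refine MvPolynomial.rename_inl_dvd_iff.2 fun d => hV _ fun y hy => ?_
  have hmap : MvPolynomial.map (MvPolynomial.aeval y : MvPolynomial X K →ₐ[K] ℝ).toRingHom
      (MvPolynomial.sumAlgEquivRight X U K h) = 0 := by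
    refine MvPolynomial.funext fun u => ?_
    rw [map_zero, MvPolynomial.eval_map, ← hh (Sum.elim y u) hy,
      MvPolynomial.aeval_eq_eval₂_sumAlgEquivRight]
    rfl
  have := congrArg (MvPolynomial.coeff d) hmap
  rwa [MvPolynomial.coeff_map, MvPolynomial.coeff_zero] at this

theorem IsIrredAlgSet.isAlgComponent_cylinder {f : MvPolynomial X K} (hf : Irreducible f)
    {V : Set (X → ℝ)} (hVne : V.Nonempty) (hVf : V = {x | MvPolynomial.aeval x f = 0})
    (hV : ∀ g : MvPolynomial X K, (∀ y ∈ V, MvPolynomial.aeval y g = 0) → f ∣ g)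
    {p : MvPolynomial (X ⊕ U) K} (hp : p ≠ 0) (hfp : MvPolynomial.rename Sum.inl f ∣ p) :
    IsAlgComponent K {z : X ⊕ U → ℝ | (fun i => z (Sum.inl i)) ∈ V}
      {z | MvPolynomial.aeval z p = 0} := by
  set F : MvPolynomial (X ⊕ U) K := MvPolynomial.rename Sum.inl f with hF
  have hFprime : Prime F := MvPolynomial.prime_rename_inl hf.prime
  have hcyl : {z : X ⊕ U → ℝ | (fun i => z (Sum.inl i)) ∈ V} =
      {z | MvPolynomial.aeval z F = 0} := by
    ext z
    rw [mem_ofPred_eq, hVf, mem_ofPred_eq, mem_ofPred_eq, hF, MvPolynomial.aeval_rename]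
    rfl
  have hdvd : ∀ h : MvPolynomial (X ⊕ U) K,
      (∀ z ∈ {z : X ⊕ U → ℝ | MvPolynomial.aeval z F = 0}, MvPolynomial.aeval z h = 0) →
        F ∣ h := fun h hh =>
    MvPolynomial.rename_inl_dvd_of_forall hV fun z hz => hh z (by rw [← hcyl]; exact hz)
  have hzero : ∀ {a b : MvPolynomial (X ⊕ U) K} (z : X ⊕ U → ℝ), a ∣ b →
      MvPolynomial.aeval z a = 0 → MvPolynomial.aeval z b = 0 := by
    rintro a _ z ⟨c, rfl⟩ hz
    rw [map_mul, hz, zero_mul]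
  have hirr : IsIrredAlgSet K {z : X ⊕ U → ℝ | MvPolynomial.aeval z F = 0} := by
    refine ⟨isAlgSet_iff.2 ⟨F, rfl⟩, ?_, ?_⟩
    · obtain ⟨x, hx⟩ := hVne
      exact ⟨Sum.elim x 0, by rw [← hcyl]; exact hx⟩
    · rintro ⟨V₁, V₂, h₁, h₂, heq, hlt₁, hlt₂⟩
      obtain ⟨a, rfl⟩ := isAlgSet_iff.1 h₁
      obtain ⟨b, rfl⟩ := isAlgSet_iff.1 h₂
      have hab : F ∣ a * b := hdvd _ fun z hz => by
        rw [heq] at hz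
        rw [map_mul, mul_eq_zero]
        exact hz
      rcases hFprime.dvd_or_dvd hab with h | h
      · exact hlt₁.2 fun z hz => hzero z h hz
      · exact hlt₂.2 fun z hz => hzero z h hz
  rw [hcyl]
  refine ⟨hirr, fun z hz => hzero z hfp hz, fun T hT hFT hTp => ?_⟩
  obtain ⟨g, hg, hTg⟩ := hT.exists_irreducible_eq (by
    rintro rfl
    exact hp (MvPolynomial.eq_zero_of_forall_aeval_eq_zero fun z => hTp (mem_univ z)))
  have hFg : F ∣ g := hdvd g fun z hz => by
    have := hFT hz
    rwa [hTg] at this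
  have hgF : g ∣ F := (hFprime.irreducible.associated_of_dvd hg hFg).symm.dvd
  refine Subset.antisymm (fun z hz => ?_) hFT
  rw [hTg] at hz
  exact hzero z hgF hz

theorem isAlgComponent_of_subsingleton [Subsingleton (X → ℝ)] {T V : Set (X → ℝ)}
    (hT : T.Nonempty) (hTV : T ⊆ V) : IsAlgComponent K T V := by
  have huniv : ∀ S : Set (X → ℝ), S.Nonempty → S = univ := fun S hS =>
    Subsingleton.eq_univ_of_nonempty hS
  refine ⟨⟨isAlgSet_iff.2 ⟨0, by simpa using huniv T hT⟩, hT, ?_⟩, hTV, fun T' hT' _ _ => ?_⟩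
  · rintro ⟨V₁, V₂, -, -, heq, h₁, h₂⟩
    have hempty : ∀ S : Set (X → ℝ), S ⊂ T → S = ∅ := fun S hS => by
      by_contra h
      rw [huniv S (nonempty_iff_ne_empty.2 h), huniv T hT] at hS
      exact hS.ne rfl
    rw [hempty V₁ h₁, hempty V₂ h₂, union_empty] at heq
    exact hT.ne_empty heq
  · rw [huniv T' hT'.2.1, huniv T hT]

end Cylinders
/-- If `V = Z(E(P))` is an irreducible real algebraic set over `𝕂` of dimension `n-1`, then
either `V` is one of the hyperplanes constituting `W_P`, or `V × ℝⁿ` is an irreducible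
component over `𝕂` of `Z(P) ⊆ ℝ^{2n}`. -/
theorem stmt12 (n : ℕ) (K : Subfield ℝ) (hK : RealAlgExt K)
    (P : MvPolynomial (Fin n ⊕ Fin n) ℝ) (hP : CoeffsIn K P)
    (V : Set (Fin n → ℝ)) (hVdef : V = {x | expEval P x = 0})
    (hirr : IsIrredAlgSet K V) (hdim : dimH V = ((n - 1 : ℕ) : ℝ≥0∞)) :
    (∃ d e : Fin n → ℕ, d ∈ Uexps P ∧ e ∈ Uexps P ∧ d ≠ e ∧
        V = {x : Fin n → ℝ | ∑ i, (d i : ℝ) * x i = ∑ i, (e i : ℝ) * x i}) ∨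
    IsAlgComponent K {z : Fin n ⊕ Fin n → ℝ | (fun i => z (Sum.inl i)) ∈ V}
      {z : Fin n ⊕ Fin n → ℝ | MvPolynomial.eval z P = 0} := by
  rcases n with _ | m
  · right
    obtain ⟨x, hx⟩ := hirr.2.1
    have : IsEmpty (Fin 0 ⊕ Fin 0) := inferInstance
    refine isAlgComponent_of_subsingleton ⟨Sum.elim x x, hx⟩ fun z _ => ?_
    rw [hVdef] at hx
    rw [mem_ofPred_eq, Subsingleton.elim z (Sum.elim x fun i => Real.exp (x i))]
    exact hx
  obtain ⟨p, rfl⟩ := exists_map_eq_of_coeffsIn hP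
  obtain ⟨f, hf, hVf, hdvd⟩ := hirr.exists_irreducible_dvd_of_dimH_eq hK hdim
  set Q := MvPolynomial.sumAlgEquivRight (Fin (m + 1)) (Fin (m + 1)) K p with hQ
  have hVQ : ∀ y ∈ V, MvPolynomial.eval₂
      (MvPolynomial.aeval y : MvPolynomial (Fin (m + 1)) K →ₐ[K] ℝ)
      (fun i => Real.exp (y i)) Q = 0 := fun y hy => by
    rw [hVdef, mem_ofPred_eq, expEval, MvPolynomial.eval_map, ← MvPolynomial.aeval_def,
      MvPolynomial.aeval_eq_eval₂_sumAlgEquivRight] at hy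
    exact hy
  have hp0 : p ≠ 0 := by
    rintro rfl
    obtain ⟨x, hx⟩ := (ne_univ_iff_exists_notMem V).1 (ne_univ_of_dimH_eq hdim)
    exact hx (by simp [hVdef, expEval])
  have hexps : ∀ d ∈ Q.support, (d : Fin (m + 1) → ℕ) ∈
      Uexps (MvPolynomial.map (algebraMap K ℝ) p) := fun d hd => by
    obtain ⟨k, hk, hkd⟩ := MvPolynomial.exists_mem_support_of_mem_support_sumAlgEquivRight hd
    refine ⟨k, ?_, funext hkd⟩
    rwa [MvPolynomial.support_map_of_injective _ (algebraMap K ℝ).injective]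
  by_cases hcase : ∃ d ∈ Q.support, ∃ e ∈ Q.support, d ≠ e ∧ f ∣ MvPolynomial.expDiff K d e
  · obtain ⟨d, hd, e, he, hde, hfde⟩ := hcase
    exact Or.inl ⟨d, e, hexps d hd, hexps e he, fun h => hde (DFunLike.coe_injective h),
      hVf.trans (MvPolynomial.zeroSet_eq_of_dvd_expDiff hf hde hfde)⟩
  · push Not at hcase
    right
    have hcoeff : ∀ d, f ∣ Q.coeff d := fun d => by
      have hprod : f ∣ Q.coeff d * ∏ k ∈ Q.support.offDiag, MvPolynomial.expDiff K k.1 k.2 := by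
        refine hdvd _ fun y hyV hy => ?_
        rw [map_mul, map_prod, mul_eq_zero, Finset.prod_eq_zero_iff, or_iff_not_imp_right]
        intro hne
        refine MvPolynomial.aeval_coeff_eq_zero_of_exp hK Q hy (hVQ y hyV)
          (fun k hk e he hke h => hne ⟨(k, e), ?_, h⟩) d
        exact Finset.mem_offDiag.2 ⟨hk, he, hke⟩
      refine (hf.prime.dvd_or_dvd hprod).resolve_right fun h => ?_
      obtain ⟨⟨k, e⟩, hke, h⟩ := hf.prime.exists_mem_finset_dvd h
      obtain ⟨hk, he, hne⟩ := Finset.mem_offDiag.1 hke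
      exact hcase k hk e he hne h
    have hcomp := IsIrredAlgSet.isAlgComponent_cylinder hf hirr.2.1 hVf
      (fun g hg => hdvd g fun y hy _ => hg y hy) hp0 (MvPolynomial.rename_inl_dvd_iff.2 hcoeff)
    simpa only [MvPolynomial.eval_map, ← MvPolynomial.aeval_def] using hcomp

end
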